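/- If f is totally convex (totally convex at every point of E), x₀ ∈ E, and (x_n) is a sequence in E such that the sequence of Bregman distances (D_f(x_n, x₀)) is bounded, then the sequence (x_n) is bounded. -/

import Mathlib

open Bornology

/-- If `D` is bounded below by `ν` on the unit sphere around `x₀`, where `D` is the gap between a
convex function and an affine function touching it at `x₀`, then `D` grows at least linearly. -/
lemma ConvexOn.mul_norm_sub_le_of_forall_unit_sphere
    {E : Type*} [NormedAddCommGroup E] [NormedSpace ℝ E] {f : E → ℝ}
    (hconv : ConvexOn ℝ Set.univ f) (φ : E →L[ℝ] ℝ) {x₀ : E} {ν : ℝ}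
    (hν : ∀ z : E, ‖z - x₀‖ = 1 → ν ≤ f z - f x₀ - φ (z - x₀))
    {y : E} (hy : 1 ≤ ‖y - x₀‖) :
    ν * ‖y - x₀‖ ≤ f y - f x₀ - φ (y - x₀) := by
  set r := ‖y - x₀‖ with hr
  have hr0 : 0 < r := by linarith
  have hz : (1 - r⁻¹) • x₀ + r⁻¹ • y - x₀ = r⁻¹ • (y - x₀) := by module
  have hsphere := hν ((1 - r⁻¹) • x₀ + r⁻¹ • y) (by
    rw [hz, norm_smul, ← hr, norm_inv, Real.norm_of_nonneg hr0.le, inv_mul_cancel₀ hr0.ne'])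
  have hcomb := hconv.2 (Set.mem_univ x₀) (Set.mem_univ y)
    (sub_nonneg.2 (inv_le_one_of_one_le₀ hy)) (inv_nonneg.2 hr0.le) (by ring)
  rw [hz, map_smul] at hsphere
  simp only [smul_eq_mul] at hsphere hcomb
  have hscaled : ν ≤ r⁻¹ * (f y - f x₀ - φ (y - x₀)) := by linarith
  rwa [inv_mul_eq_div, le_div_iff₀ hr0] at hscaled

/-- If `f` is totally convex (totally convex at every point of `E`), `x₀ ∈ E`, and
`(x_n)` is a sequence in `E` such that the sequence of Bregman distances
`(D_f(x_n, x₀))` is bounded, then the sequence `(x_n)` is bounded. -/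
theorem bounded_of_bregman_distances_bounded
    {E : Type*} [NormedAddCommGroup E] [NormedSpace ℝ E] [CompleteSpace E]
    (f : E → ℝ) (f' : E → (E →L[ℝ] ℝ))
    (hconv : ConvexOn ℝ Set.univ f)
    (hdiff : ∀ x : E, HasFDerivAt f (f' x) x)
    (D : E → E → ℝ)
    (hD : ∀ y x : E, D y x = f y - f x - f' x (y - x))
    (htc : ∀ x : E, ∀ t : ℝ, 0 < t →
      0 < sInf {d : ℝ | ∃ y : E, ‖y - x‖ = t ∧ d = D y x})
    (x₀ : E) (x : ℕ → E)
    (hbdd : IsBounded (Set.range fun n => D (x n) x₀)) :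
    IsBounded (Set.range x) := by
  set S : Set ℝ := {d : ℝ | ∃ y : E, ‖y - x₀‖ = 1 ∧ d = D y x₀}
  have hpos : 0 < sInf S := htc x₀ 1 one_pos
  have hbelow : BddBelow S := by
    by_contra h
    exact hpos.ne' (Real.sInf_of_not_bddBelow h)
  have hν : ∀ z : E, ‖z - x₀‖ = 1 → sInf S ≤ f z - f x₀ - f' x₀ (z - x₀) :=
    fun z hz => csInf_le hbelow ⟨z, hz, (hD z x₀).symm⟩
  obtain ⟨M, hM⟩ := hbdd.bddAbove
  refine (Metric.isBounded_closedBall (x := x₀) (r := max 1 (M / sInf S))).subset ?_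
  rintro _ ⟨n, rfl⟩
  rw [mem_closedBall_iff_norm, le_max_iff]
  refine (le_total ‖x n - x₀‖ 1).imp_right fun hn => ?_
  have hgrowth := hconv.mul_norm_sub_le_of_forall_unit_sphere (f' x₀) hν hn
  have hle : D (x n) x₀ ≤ M := hM ⟨n, rfl⟩
  rw [le_div_iff₀' hpos]
  linarith [hD (x n) x₀]
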